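/- Let 𝒯 be a first-order theory over a signature Σ, let A and B be disjoint sets of sentences over expansions of Σ by free symbols, and let Σ_I be the expansion of Σ by the free symbols occurring in both A and B. Call a formula A-colorable (resp. B-colorable) if all its non-theory symbols occur in A (resp. in B). Let ℛ be a proof system all of whose rules are sound with respect to 𝒯, and suppose there is a local refutation of A ∪ B in ℛ: a proof of false from A ∪ B in ℛ in which every inference step consists entirely of A-colorable formulas or entirely of B-colorable formulas. Then there exists a Σ_I-sentence I such that A ⊨_𝒯 I and B ∪ {I} ⊨_𝒯 false, i.e. A and B have a 𝒯-interpolant. -/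

import Mathlib

open FirstOrder Language

universe u v

/-- A function symbol (paired with its arity) occurs in a term. -/
inductive TFunc {L : FirstOrder.Language.{u, v}} {α : Type*} :
    (Σ n, L.Functions n) → L.Term α → Prop
  | head {k : ℕ} (f : L.Functions k) (ts : Fin k → L.Term α) : TFunc ⟨k, f⟩ (Term.func f ts)
  | arg {k : ℕ} (f : L.Functions k) (ts : Fin k → L.Term α) (i : Fin k) {g} :
      TFunc g (ts i) → TFunc g (Term.func f ts)

/-- A function symbol occurs in a bounded formula. -/
inductive FFunc {L : FirstOrder.Language.{u, v}} {α : Type*} :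
    ∀ {n : ℕ}, (Σ k, L.Functions k) → L.BoundedFormula α n → Prop
  | equal_l {n} {t₁ t₂ : L.Term (α ⊕ Fin n)} {g} (h : TFunc g t₁) :
      FFunc g (BoundedFormula.equal t₁ t₂)
  | equal_r {n} {t₁ t₂ : L.Term (α ⊕ Fin n)} {g} (h : TFunc g t₂) :
      FFunc g (BoundedFormula.equal t₁ t₂)
  | rel {n l : ℕ} {R : L.Relations l} {ts : Fin l → L.Term (α ⊕ Fin n)} {g} (i : Fin l)
      (h : TFunc g (ts i)) : FFunc g (BoundedFormula.rel R ts)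
  | imp_l {n} {φ ψ : L.BoundedFormula α n} {g} (h : FFunc g φ) : FFunc g (φ.imp ψ)
  | imp_r {n} {φ ψ : L.BoundedFormula α n} {g} (h : FFunc g ψ) : FFunc g (φ.imp ψ)
  | all {n} {φ : L.BoundedFormula α (n + 1)} {g} (h : FFunc g φ) : FFunc g φ.all

/-- A relation symbol occurs in a bounded formula. -/
inductive FRel {L : FirstOrder.Language.{u, v}} {α : Type*} :
    ∀ {n : ℕ}, (Σ k, L.Relations k) → L.BoundedFormula α n → Prop
  | rel {n l : ℕ} {R : L.Relations l} {ts : Fin l → L.Term (α ⊕ Fin n)} :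
      FRel ⟨l, R⟩ (BoundedFormula.rel R ts)
  | imp_l {n} {φ ψ : L.BoundedFormula α n} {g} (h : FRel g φ) : FRel g (φ.imp ψ)
  | imp_r {n} {φ ψ : L.BoundedFormula α n} {g} (h : FRel g ψ) : FRel g (φ.imp ψ)
  | all {n} {φ : L.BoundedFormula α (n + 1)} {g} (h : FRel g φ) : FRel g φ.all

/-- A structure (given explicitly) satisfies every sentence in `S`. -/
def SatisfiesAll {L : FirstOrder.Language.{u, v}} (M : Type) (str : L.Structure M)
    (S : Set L.Sentence) : Prop :=
  letI := str
  ∀ φ ∈ S, M ⊨ φ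

/-- `S ⊨_T φ` : semantic entailment modulo the theory `T`. -/
def TEntails {L : FirstOrder.Language.{u, v}} (T : L.Theory) (S : Set L.Sentence)
    (φ : L.Sentence) : Prop :=
  ∀ (M : Type) (str : L.Structure M), Nonempty M →
    SatisfiesAll M str T → SatisfiesAll M str S → (letI := str; M ⊨ φ)

/-- The theory uses only symbols of the signature given by `SF`, `SR`. -/
def TheoryOverSig {L : FirstOrder.Language.{u, v}} (SF : Set (Σ k, L.Functions k))
    (SR : Set (Σ k, L.Relations k)) (T : L.Theory) : Prop :=
  ∀ φ ∈ T, (∀ g, FFunc g φ → g ∈ SF) ∧ (∀ g, FRel g φ → g ∈ SR)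

/-- `φ` is a `Σ_I`-sentence: each of its non-theory symbols occurs both in `A`
and in `B`. -/
def SigISentence {L : FirstOrder.Language.{u, v}} (SF : Set (Σ k, L.Functions k))
    (SR : Set (Σ k, L.Relations k)) (A B : Set L.Sentence) (φ : L.Sentence) : Prop :=
  (∀ g, FFunc g φ → g ∉ SF → (∃ ψ ∈ A, FFunc g ψ) ∧ ∃ ψ ∈ B, FFunc g ψ) ∧
  (∀ g, FRel g φ → g ∉ SR → (∃ ψ ∈ A, FRel g ψ) ∧ ∃ ψ ∈ B, FRel g ψ)

attribute [local instance] Classical.propDecidable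

/-- `φ`'s non-theory symbols all occur in the set `ext` (`ext`-colorability). -/
def ColorableBy {L : FirstOrder.Language.{u, v}} (SF : Set (Σ k, L.Functions k))
    (SR : Set (Σ k, L.Relations k)) (ext : Set L.Sentence) (φ : L.Sentence) : Prop :=
  (∀ g, FFunc g φ → g ∈ SF ∨ ∃ ψ ∈ ext, FFunc g ψ) ∧
  (∀ g, FRel g φ → g ∈ SR ∨ ∃ ψ ∈ ext, FRel g ψ)

/-- A labelled tree of sentences: the root label together with the immediate
subtrees. -/
inductive ProofTree (L : FirstOrder.Language.{u, v}) : Type max u v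
  | node : L.Sentence → List (ProofTree L) → ProofTree L

/-- The label of the root of a proof tree. -/
def ProofTree.label {L : FirstOrder.Language.{u, v}} : ProofTree L → L.Sentence
  | node φ _ => φ

/-- `LocalProof R S CA CB D`: `D` is a local proof from `S` in the proof system
`R`: each leaf not obtained by a rule is labelled by an element of `S`, every
other node is the conclusion of an inference step of a rule of `R` whose premises
are the root labels of its immediate subtrees, and every inference step consists
entirely of `CA`-colorable or entirely of `CB`-colorable sentences. -/
inductive LocalProof {L : FirstOrder.Language.{u, v}}
    (R : Set (Finset L.Sentence → L.Sentence → Prop)) (S : Set L.Sentence)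
    (CA CB : L.Sentence → Prop) : ProofTree L → Prop
  | hyp (φ : L.Sentence) (h : φ ∈ S) : LocalProof R S CA CB (ProofTree.node φ [])
  | stepA (φ : L.Sentence) (children : List (ProofTree L))
      (r : Finset L.Sentence → L.Sentence → Prop) (hr : r ∈ R)
      (hstep : r (children.map ProofTree.label).toFinset φ)
      (hφ : CA φ) (hch : ∀ c ∈ children, CA c.label)
      (hc : ∀ c ∈ children, LocalProof R S CA CB c) :
      LocalProof R S CA CB (ProofTree.node φ children)
  | stepB (φ : L.Sentence) (children : List (ProofTree L))
      (r : Finset L.Sentence → L.Sentence → Prop) (hr : r ∈ R)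
      (hstep : r (children.map ProofTree.label).toFinset φ)
      (hφ : CB φ) (hch : ∀ c ∈ children, CB c.label)
      (hc : ∀ c ∈ children, LocalProof R S CA CB c) :
      LocalProof R S CA CB (ProofTree.node φ children)

section Interpolants

variable {L : FirstOrder.Language.{u, v}} {SF : Set (Σ k, L.Functions k)}
  {SR : Set (Σ k, L.Relations k)} {T : L.Theory} {A B : Set L.Sentence}

lemma sigISentence_symm {φ : L.Sentence} (h : SigISentence SF SR A B φ) :
    SigISentence SF SR B A φ :=
  ⟨fun g hg hS => (h.1 g hg hS).symm, fun g hg hS => (h.2 g hg hS).symm⟩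

lemma sigISentence_bot : SigISentence SF SR A B (⊥ : L.Sentence) :=
  ⟨fun _ h => (nomatch h), fun _ h => (nomatch h)⟩

lemma sigISentence_imp {φ ψ : L.Sentence} (hφ : SigISentence SF SR A B φ)
    (hψ : SigISentence SF SR A B ψ) : SigISentence SF SR A B (φ.imp ψ) := by
  constructor
  · intro g h
    cases h with
    | imp_l h => exact hφ.1 g h
    | imp_r h => exact hψ.1 g h
  · intro g h
    cases h with
    | imp_l h => exact hφ.2 g h
    | imp_r h => exact hψ.2 g h

lemma sigISentence_inf {φ ψ : L.Sentence} (hφ : SigISentence SF SR A B φ)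
    (hψ : SigISentence SF SR A B ψ) : SigISentence SF SR A B (φ ⊓ ψ) :=
  sigISentence_imp (sigISentence_imp hφ (sigISentence_imp hψ sigISentence_bot)) sigISentence_bot

lemma sigISentence_of_colorableBy {φ : L.Sentence} (hA : ColorableBy SF SR A φ)
    (hB : ColorableBy SF SR B φ) : SigISentence SF SR A B φ :=
  ⟨fun g hg hS => ⟨(hA.1 g hg).resolve_left hS, (hB.1 g hg).resolve_left hS⟩,
    fun g hg hS => ⟨(hA.2 g hg).resolve_left hS, (hB.2 g hg).resolve_left hS⟩⟩

lemma colorableBy_of_mem {φ : L.Sentence} (h : φ ∈ A) : ColorableBy SF SR A φ :=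
  ⟨fun _ hg => Or.inr ⟨φ, h, hg⟩, fun _ hg => Or.inr ⟨φ, h, hg⟩⟩

lemma tEntails_union_singleton {I φ : L.Sentence} (h : TEntails T B (I.imp φ)) :
    TEntails T (B ∪ {I}) φ := fun M str hM hT hS =>
  h M str hM hT (fun ψ hψ => hS ψ (Or.inl hψ)) (hS I (Or.inr rfl))

/-- `I` is a sentence over the common symbols which follows from `A` and which, together
with `B`, entails every sentence in `S`. -/
def Separates (SF : Set (Σ k, L.Functions k)) (SR : Set (Σ k, L.Relations k)) (T : L.Theory)
    (A B S : Set L.Sentence) (I : L.Sentence) : Prop :=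
  SigISentence SF SR A B I ∧ TEntails T A I ∧ ∀ φ ∈ S, TEntails T B (I.imp φ)

/-- A common-language consequence can be transferred from one side to the other. -/
lemma exists_separates_swap {φ : L.Sentence} (hφ : SigISentence SF SR A B φ)
    (h : ∃ I, Separates SF SR T A B {φ} I) : ∃ I, Separates SF SR T B A {φ} I := by
  obtain ⟨I, hI, hA, hB⟩ := h
  refine ⟨I.imp φ, sigISentence_symm (sigISentence_imp hI hφ), hB φ rfl, ?_⟩
  rintro _ rfl M str hM hT hS hIφ
  exact hIφ (hA M str hM hT hS)

/-- Hypotheses from either side have separators, provided they are colorable by the second. -/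
lemma exists_separates_of_mem {φ : L.Sentence} (h : φ ∈ A ∪ B) (hφ : ColorableBy SF SR B φ) :
    ∃ I, Separates SF SR T A B {φ} I := by
  rcases h with h | h
  · refine ⟨φ, sigISentence_of_colorableBy (colorableBy_of_mem h) hφ,
      fun _ _ _ _ hS => hS φ h, ?_⟩
    rintro _ rfl _ _ _ _ _ hI
    exact hI
  · refine ⟨(⊥ : L.Sentence).imp ⊥, sigISentence_imp sigISentence_bot sigISentence_bot,
      fun _ _ _ _ _ hI => hI, ?_⟩
    rintro _ rfl _ _ _ _ hS _
    exact hS _ h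

/-- Separators for the members of a list combine to a single one by conjunction. -/
lemma exists_separates_list (l : List L.Sentence)
    (h : ∀ φ ∈ l, ∃ I, Separates SF SR T A B {φ} I) :
    ∃ I, Separates SF SR T A B {φ | φ ∈ l} I := by
  induction l with
  | nil =>
    exact ⟨(⊥ : L.Sentence).imp ⊥, sigISentence_imp sigISentence_bot sigISentence_bot,
      fun _ _ _ _ _ hI => hI, fun φ hφ => by simp at hφ⟩
  | cons φ l ih =>
    obtain ⟨I, hI, hIA, hIB⟩ := h φ (by simp)
    obtain ⟨J, hJ, hJA, hJB⟩ := ih fun ψ hψ => h ψ (by simp [hψ])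
    refine ⟨I ⊓ J, sigISentence_inf hI hJ, ?_, ?_⟩
    · intro M str hM hT hS
      exact BoundedFormula.realize_inf.2 ⟨hIA M str hM hT hS, hJA M str hM hT hS⟩
    · intro ψ hψ M str hM hT hS hIJ
      obtain ⟨hIM, hJM⟩ := BoundedFormula.realize_inf.1 hIJ
      rcases List.mem_cons.1 hψ with rfl | hψ
      · exact hIB _ rfl M str hM hT hS hIM
      · exact hJB ψ hψ M str hM hT hS hJM

/-- Separators for the premises of a sound inference yield one for its conclusion. -/
lemma exists_separates_of_tEntails {φ : L.Sentence} (l : List L.Sentence)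
    (hφ : TEntails T {ψ | ψ ∈ l} φ) (h : ∀ ψ ∈ l, ∃ I, Separates SF SR T A B {ψ} I) :
    ∃ I, Separates SF SR T A B {φ} I := by
  obtain ⟨I, hI, hIA, hIB⟩ := exists_separates_list l h
  refine ⟨I, hI, hIA, ?_⟩
  rintro _ rfl M str hM hT hS hIM
  exact hφ M str hM hT fun ψ hψ => hIB ψ hψ M str hM hT hS hIM

lemma exists_separates_of_localProof {R : Set (Finset L.Sentence → L.Sentence → Prop)}
    (hsound : ∀ r ∈ R, ∀ (prems : Finset L.Sentence) (φ : L.Sentence),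
      r prems φ → TEntails T (↑prems) φ) {D : ProofTree L}
    (hD : LocalProof R (A ∪ B) (ColorableBy SF SR A) (ColorableBy SF SR B) D) :
    (ColorableBy SF SR B D.label → ∃ I, Separates SF SR T A B {D.label} I) ∧
      (ColorableBy SF SR A D.label → ∃ I, Separates SF SR T B A {D.label} I) := by
  induction hD with
  | hyp φ h =>
    exact ⟨exists_separates_of_mem h, exists_separates_of_mem (Set.union_comm A B ▸ h)⟩
  | stepA φ children r hr hstep hφ hch _ ih =>
    have key : ∃ I, Separates SF SR T B A {φ} I := by
      refine exists_separates_of_tEntails (children.map ProofTree.label) ?_ ?_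
      · simpa using hsound r hr _ φ hstep
      · simpa using fun c hc => (ih c hc).2 (hch c hc)
    exact ⟨fun hB => exists_separates_swap (sigISentence_of_colorableBy hB hφ) key,
      fun _ => key⟩
  | stepB φ children r hr hstep hφ hch _ ih =>
    have key : ∃ I, Separates SF SR T A B {φ} I := by
      refine exists_separates_of_tEntails (children.map ProofTree.label) ?_ ?_
      · simpa using hsound r hr _ φ hstep
      · simpa using fun c hc => (ih c hc).1 (hch c hc)
    exact ⟨fun _ => key,
      fun hA => exists_separates_swap (sigISentence_of_colorableBy hA hφ) key⟩

end Interpolants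

/-- If all rules of the proof system `R` are sound for the
theory `T` and there is a local refutation of `A ∪ B` in `R`, then `A` and `B`
have a `T`-interpolant: a `Σ_I`-sentence `I` with `A ⊨_T I` and `B ∪ {I} ⊨_T ⊥`. -/
theorem local_refutation_yields_interpolant
    {L : FirstOrder.Language.{u, v}} (SF : Set (Σ k, L.Functions k))
    (SR : Set (Σ k, L.Relations k)) (T : L.Theory) (hT : TheoryOverSig SF SR T)
    (A B : Set L.Sentence) (hABdisj : Disjoint A B)
    (R : Set (Finset L.Sentence → L.Sentence → Prop))
    (hsound : ∀ r ∈ R, ∀ (prems : Finset L.Sentence) (φ : L.Sentence),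
      r prems φ → TEntails T (↑prems) φ)
    (href : ∃ D : ProofTree L,
      LocalProof R (A ∪ B) (ColorableBy SF SR A) (ColorableBy SF SR B) D ∧
      D.label = ⊥) :
    ∃ I : L.Sentence, SigISentence SF SR A B I ∧
      TEntails T A I ∧ TEntails T (B ∪ {I}) ⊥ := by
  obtain ⟨D, hD, hbot⟩ := href
  have h := (exists_separates_of_localProof hsound hD).1
  rw [hbot] at h
  obtain ⟨I, hI, hIA, hIB⟩ := h ⟨fun _ h => (nomatch h), fun _ h => (nomatch h)⟩
  exact ⟨I, hI, hIA, tEntails_union_singleton (hIB ⊥ rfl)⟩
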